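/- arXiv:1907.07624 — 9 statements merged into one kernel-verified Lean document; each statement's English description precedes it below -/
import Mathlib

section
/- Let n ≥ 2 be an integer, and let I be an ideal of the polynomial ring ℂ[u,v] such that the radical of I equals the ideal (u,v) generated by the two variables and such that dim_ℂ ℂ[u,v]/I = n. Let f : ℂ[w] → ℂ[u,v] be the ℂ-algebra homomorphism determined by w ↦ u² + v². Then dim_ℂ ℂ[w]/f⁻¹(I) < n. (Geometrically: for the projection π(u,v) = u² + v², any zero-dimensional length-n subscheme of ℂ² supported at the origin projects to a subscheme of ℂ of length strictly less than n.) -/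
open MvPolynomial

/-- If `w = u² + v²` is nilpotent and divides both `u` and `v`, then `w = 0`. -/
theorem eq_zero_of_isNilpotent_of_dvd {A : Type*} [CommRing A] {u v w : A}
    (hw : w = u ^ 2 + v ^ 2) (hnil : IsNilpotent w) (hu : w ∣ u) (hv : w ∣ v) : w = 0 := by
  obtain ⟨a, ha⟩ := hu
  obtain ⟨b, hb⟩ := hv
  have hunit : IsUnit (1 - w * (a ^ 2 + b ^ 2)) :=
    (Commute.isNilpotent_mul_right (Commute.all _ _) hnil).isUnit_one_sub
  refine (hunit.mul_left_eq_zero).1 ?_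
  calc w * (1 - w * (a ^ 2 + b ^ 2)) = w - ((w * a) ^ 2 + (w * b) ^ 2) := by ring
    _ = 0 := by rw [← ha, ← hb, ← hw, sub_self]

/-- Let `n ≥ 2` and let `I` be an ideal of `ℂ[u,v]` whose radical is the
ideal `(u, v)` and with `dim_ℂ ℂ[u,v]/I = n`.  For the `ℂ`-algebra map
`f : ℂ[w] → ℂ[u,v]`, `w ↦ u² + v²`, one has `dim_ℂ ℂ[w]/f⁻¹(I) < n`. -/
theorem statement0 (n : ℕ) (hn : 2 ≤ n) (I : Ideal (MvPolynomial (Fin 2) ℂ))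
    (hrad : I.radical = Ideal.span {X 0, X 1})
    (hdim : Module.finrank ℂ (MvPolynomial (Fin 2) ℂ ⧸ I) = n) :
    Module.finrank ℂ
      (Polynomial ℂ ⧸ Ideal.comap
        (Polynomial.aeval (X 0 ^ 2 + X 1 ^ 2 : MvPolynomial (Fin 2) ℂ) :
          Polynomial ℂ →ₐ[ℂ] MvPolynomial (Fin 2) ℂ) I) < n := by
  set w : MvPolynomial (Fin 2) ℂ := X 0 ^ 2 + X 1 ^ 2 with hw
  set J := Ideal.comap (Polynomial.aeval w : Polynomial ℂ →ₐ[ℂ] MvPolynomial (Fin 2) ℂ) I with hJ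
  have : Module.Finite ℂ (MvPolynomial (Fin 2) ℂ ⧸ I) :=
    Module.finite_of_finrank_pos (by omega)
  let g : (Polynomial ℂ ⧸ J) →ₐ[ℂ] (MvPolynomial (Fin 2) ℂ ⧸ I) :=
    Ideal.quotientMapₐ I (Polynomial.aeval w) le_rfl
  have hg : Function.Injective g := Ideal.quotientMap_injective
  have hle := LinearMap.finrank_le_finrank_of_injective (f := g.toLinearMap) hg
  rw [hdim] at hle
  refine lt_of_le_of_ne hle fun heq => ?_
  have : Module.Finite ℂ (Polynomial ℂ ⧸ J) := Module.finite_of_finrank_pos (by omega)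
  have hsurj : Function.Surjective g :=
    (LinearMap.injective_iff_surjective_of_finrank_eq_finrank (f := g.toLinearMap)
      (heq.trans hdim.symm)).1 hg
  have hrep (x : MvPolynomial (Fin 2) ℂ) : ∃ p : Polynomial ℂ,
      Ideal.Quotient.mk I (Polynomial.aeval w p) = Ideal.Quotient.mk I x := by
    obtain ⟨y, hy⟩ := hsurj (Ideal.Quotient.mk I x)
    obtain ⟨p, rfl⟩ := Ideal.Quotient.mk_surjective y
    exact ⟨p, hy⟩
  have hsplit (p : Polynomial ℂ) :
      Polynomial.aeval w p = w * Polynomial.aeval w p.divX + C (p.coeff 0) := by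
    conv_lhs => rw [← Polynomial.X_mul_divX_add p]
    rw [map_add, map_mul, Polynomial.aeval_X, Polynomial.aeval_C, MvPolynomial.algebraMap_eq]
  have hI (x : MvPolynomial (Fin 2) ℂ) (hx : x ∈ I) : constantCoeff x = 0 := by
    have hx' : x ∈ Ideal.span {X 0, X 1} := hrad ▸ Ideal.le_radical hx
    have hker : Ideal.span {X 0, X 1} ≤
        RingHom.ker (constantCoeff : MvPolynomial (Fin 2) ℂ →+* ℂ) := by
      rw [Ideal.span_le]
      rintro y (rfl | rfl) <;> simp
    exact hker hx'
  have hdvd (i : Fin 2) : Ideal.Quotient.mk I w ∣ Ideal.Quotient.mk I (X i) := by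
    obtain ⟨p, hp⟩ := hrep (X i)
    have h0 := hI _ (Ideal.Quotient.eq.1 hp)
    rw [hsplit] at h0
    have hc : p.coeff 0 = 0 := by simpa [hw] using h0
    rw [← hp, hsplit, hc, C_0, add_zero, map_mul]
    exact dvd_mul_right _ _
  have hnil : IsNilpotent (Ideal.Quotient.mk I w) := by
    have hmem : w ∈ I.radical := by
      rw [hrad]
      exact add_mem
        (Ideal.pow_mem_of_mem _ (Ideal.subset_span (by simp)) 2 two_pos)
        (Ideal.pow_mem_of_mem _ (Ideal.subset_span (by simp)) 2 two_pos)
    obtain ⟨k, hk⟩ := hmem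
    exact ⟨k, by rw [← map_pow, Ideal.Quotient.eq_zero_iff_mem]; exact hk⟩
  have hw0 : Ideal.Quotient.mk I w = 0 :=
    eq_zero_of_isNilpotent_of_dvd (by simp [hw]) hnil (hdvd 0) (hdvd 1)
  have hone : Module.finrank ℂ (MvPolynomial (Fin 2) ℂ ⧸ I) ≤ 1 := by
    refine finrank_le_one 1 fun x => ?_
    obtain ⟨x, rfl⟩ := Ideal.Quotient.mk_surjective x
    obtain ⟨p, hp⟩ := hrep x
    refine ⟨p.coeff 0, ?_⟩
    rw [← hp, hsplit, map_add, map_mul, hw0, zero_mul, zero_add, ← Algebra.algebraMap_eq_smul_one]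
    rfl
  omega
end

section
/- Let n ≥ 1 be an integer, and let I be an ideal of ℂ[u,v] such that the radical of I equals the ideal (u,v) and such that dim_ℂ ℂ[u,v]/I = n. Then (u² + v²)^⌈n/2⌉ ∈ I, and consequently, for the ℂ-algebra homomorphism f : ℂ[w] → ℂ[u,v] with f(w) = u² + v², one has dim_ℂ ℂ[w]/f⁻¹(I) ≤ ⌈n/2⌉ (in particular 2·dim_ℂ ℂ[w]/f⁻¹(I) ≤ n + 1). -/
open MvPolynomial

/-- In a finite-dimensional commutative algebra, a nilpotent ideal `J` satisfies `J ^ dim = ⊥`. -/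
theorem Ideal.pow_finrank_eq_bot_of_isNilpotent {K A : Type*} [Field K] [CommRing A] [Algebra K A]
    [FiniteDimensional K A] {J : Ideal A} (hJ : IsNilpotent J) :
    J ^ Module.finrank K A = ⊥ := by
  obtain ⟨N, hN⟩ := hJ
  have key (i : ℕ) : J ^ i = ⊥ ∨
      Module.finrank K ((J ^ i).restrictScalars K) + i ≤ Module.finrank K A := by
    induction i with
    | zero => exact Or.inr (Submodule.finrank_le _)
    | succ i ih =>
      refine or_iff_not_imp_left.mpr fun hne => ?_
      have hlt : J ^ (i + 1) < J ^ i := by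
        refine lt_of_le_of_ne (Ideal.pow_le_pow_right i.le_succ) fun heq => hne ?_
        have hstab (j : ℕ) : J ^ (i + 1) = J ^ (i + 1 + j) := by
          induction j with
          | zero => rfl
          | succ j ihj => rw [← add_assoc, pow_succ J (i + 1 + j), ← ihj, heq, ← pow_succ, heq]
        rw [hstab N, pow_add, hN, mul_zero, Submodule.zero_eq_bot]
      have hi : J ^ i ≠ ⊥ := fun h => not_lt_bot (h ▸ hlt)
      have hrank := Submodule.finrank_lt_finrank_of_lt
        (show (J ^ (i + 1)).restrictScalars K < (J ^ i).restrictScalars K from hlt)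
      have := ih.resolve_left hi
      omega
  refine (key _).elim id fun h => ?_
  have h0 : Module.finrank K ((J ^ Module.finrank K A).restrictScalars K) = 0 := by omega
  simpa using Submodule.finrank_eq_zero.mp h0

/-- In a Noetherian algebra over a field, an ideal `I` of finite codimension `d` contains the
`d`-th power of its radical. -/
theorem Ideal.radical_pow_finrank_quotient_le {K R : Type*} [Field K] [CommRing R] [Algebra K R]
    [IsNoetherianRing R] (I : Ideal R) [FiniteDimensional K (R ⧸ I)] :
    I.radical ^ Module.finrank K (R ⧸ I) ≤ I := by
  obtain ⟨N, hN⟩ := I.exists_radical_pow_le_of_fg (IsNoetherian.noetherian _)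
  have hnil : IsNilpotent (I.radical.map (Ideal.Quotient.mk I)) :=
    ⟨N, by rwa [← Ideal.map_pow, Submodule.zero_eq_bot, Ideal.map_eq_bot_iff_le_ker,
      Ideal.mk_ker]⟩
  have h := Ideal.pow_finrank_eq_bot_of_isNilpotent (K := K) hnil
  rwa [← Ideal.map_pow, Ideal.map_eq_bot_iff_le_ker, Ideal.mk_ker] at h

/-- An ideal of `K[X]` containing `X ^ k` has codimension at most `k`. -/
theorem Polynomial.finrank_quotient_le_of_X_pow_mem {K : Type*} [Field K] {J : Ideal (Polynomial K)}
    {k : ℕ} (h : (Polynomial.X : Polynomial K) ^ k ∈ J) :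
    Module.finrank K (Polynomial K ⧸ J) ≤ k := by
  have hle : Ideal.span {(Polynomial.X : Polynomial K) ^ k} ≤ J :=
    (Ideal.span_singleton_le_iff_mem J).mpr h
  have hmonic : ((Polynomial.X : Polynomial K) ^ k).Monic := Polynomial.monic_X_pow k
  have : Module.Finite K (Polynomial K ⧸ Ideal.span {(Polynomial.X : Polynomial K) ^ k}) :=
    hmonic.finite_quotient
  calc Module.finrank K (Polynomial K ⧸ J)
      ≤ Module.finrank K (Polynomial K ⧸ Ideal.span {(Polynomial.X : Polynomial K) ^ k}) :=
        LinearMap.finrank_le_finrank_of_surjective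
          (f := (Ideal.Quotient.factorₐ K hle).toLinearMap) (Ideal.Quotient.factor_surjective hle)
    _ = k := by
      rw [finrank_quotient_span_eq_natDegree, Polynomial.natDegree_X_pow]

/-- Let `n ≥ 1` and let `I` be an ideal of `ℂ[u,v]` whose radical is the
ideal `(u, v)` and with `dim_ℂ ℂ[u,v]/I = n`.  Then `(u² + v²)^⌈n/2⌉ ∈ I`, and for the
`ℂ`-algebra map `f : ℂ[w] → ℂ[u,v]`, `w ↦ u² + v²`, one has
`dim_ℂ ℂ[w]/f⁻¹(I) ≤ ⌈n/2⌉` (in particular `2 · dim_ℂ ℂ[w]/f⁻¹(I) ≤ n + 1`).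
Here `⌈n/2⌉ = (n + 1) / 2` in natural number arithmetic. -/
theorem statement2 (n : ℕ) (hn : 1 ≤ n) (I : Ideal (MvPolynomial (Fin 2) ℂ))
    (hrad : I.radical = Ideal.span {X 0, X 1})
    (hdim : Module.finrank ℂ (MvPolynomial (Fin 2) ℂ ⧸ I) = n) :
    (X 0 ^ 2 + X 1 ^ 2 : MvPolynomial (Fin 2) ℂ) ^ ((n + 1) / 2) ∈ I ∧
      Module.finrank ℂ
        (Polynomial ℂ ⧸ Ideal.comap
          (Polynomial.aeval (X 0 ^ 2 + X 1 ^ 2 : MvPolynomial (Fin 2) ℂ) :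
            Polynomial ℂ →ₐ[ℂ] MvPolynomial (Fin 2) ℂ) I) ≤ (n + 1) / 2 ∧
      2 * Module.finrank ℂ
        (Polynomial ℂ ⧸ Ideal.comap
          (Polynomial.aeval (X 0 ^ 2 + X 1 ^ 2 : MvPolynomial (Fin 2) ℂ) :
            Polynomial ℂ →ₐ[ℂ] MvPolynomial (Fin 2) ℂ) I) ≤ n + 1 := by
  have : FiniteDimensional ℂ (MvPolynomial (Fin 2) ℂ ⧸ I) :=
    Module.finite_of_finrank_pos (by omega)
  have hpow := I.radical_pow_finrank_quotient_le (K := ℂ)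
  rw [hdim, hrad] at hpow
  have hsq : (X 0 ^ 2 + X 1 ^ 2 : MvPolynomial (Fin 2) ℂ) ∈
      (Ideal.span {X 0, X 1} : Ideal (MvPolynomial (Fin 2) ℂ)) ^ 2 :=
    add_mem (Ideal.pow_mem_pow (Ideal.subset_span (by simp)) 2)
      (Ideal.pow_mem_pow (Ideal.subset_span (by simp)) 2)
  have hmem : (X 0 ^ 2 + X 1 ^ 2 : MvPolynomial (Fin 2) ℂ) ^ ((n + 1) / 2) ∈ I := by
    have h := Ideal.pow_mem_pow hsq ((n + 1) / 2)
    rw [← pow_mul] at h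
    exact hpow (Ideal.pow_le_pow_right (by omega) h)
  have hrank : Module.finrank ℂ
      (Polynomial ℂ ⧸ Ideal.comap
        (Polynomial.aeval (X 0 ^ 2 + X 1 ^ 2 : MvPolynomial (Fin 2) ℂ) :
          Polynomial ℂ →ₐ[ℂ] MvPolynomial (Fin 2) ℂ) I) ≤ (n + 1) / 2 :=
    Polynomial.finrank_quotient_le_of_X_pow_mem (by simpa [Ideal.mem_comap] using hmem)
  exact ⟨hmem, hrank, by omega⟩
end

section
/- Let n, m be integers with 1 ≤ n and 2n ≤ m, and let a, b, c ∈ ℂⁿ, d ∈ ℂ^{m−n}. Then the characteristic polynomial of the Slodowy-slice matrix M(a,b,c,d) factors as det(t·1ₘ − M(a,b,c,d)) = p_a(t)·q_d(t) − r_b(t)·s_c(t) in ℂ[t]. (This is the identity det(tI − A) = A(t)D(t) − B(t)C(t) used to identify the fibres of the adjoint quotient map restricted to the two-Jordan-block slice S_{n,m}, with the sign conventions fixed by the displayed matrix.) -/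
/-- `p_a(t) = tᵏ − Σ_{i=1}^{k} a_i t^{k−i}` (for a 1-based family `a`, here indexed by
`Fin k`, so that `a ⟨i-1⟩ = a_i`). -/
noncomputable def charSlicePoly (k : ℕ) (a : Fin k → ℂ) : Polynomial ℂ :=
  Polynomial.X ^ k - ∑ i : Fin k, Polynomial.C (a i) * Polynomial.X ^ (k - 1 - i.val)

/-- `r_b(t) = Σ_{i=1}^{k} b_i t^{k−i}`. -/
noncomputable def lowSlicePoly (k : ℕ) (b : Fin k → ℂ) : Polynomial ℂ :=
  ∑ i : Fin k, Polynomial.C (b i) * Polynomial.X ^ (k - 1 - i.val)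

/-- The Slodowy-slice matrix `M(a,b,c,d)`: the `m × m` complex matrix (with rows and columns
indexed by `Fin m`, where the index `i : Fin m` corresponds to the 1-based index `i.val + 1`)
whose only nonzero entries are `M_{i,1} = a_i` for `1 ≤ i ≤ n`, `M_{m−n+i,1} = c_i` for
`1 ≤ i ≤ n`, `M_{i,n+1} = b_i` for `1 ≤ i ≤ n`, `M_{n+i,n+1} = d_i` for `1 ≤ i ≤ m−n`, and
`M_{i,i+1} = 1` for `1 ≤ i ≤ n−1` and for `n+1 ≤ i ≤ m−1`. -/
def slodowyMatrix (n m : ℕ) (a b c : Fin n → ℂ) (d : Fin (m - n) → ℂ) :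
    Matrix (Fin m) (Fin m) ℂ := fun i j =>
  if j.val = 0 then
    if h : i.val < n then a ⟨i.val, h⟩
    else if h2 : m - n ≤ i.val ∧ i.val - (m - n) < n then c ⟨i.val - (m - n), h2.2⟩
    else 0
  else if j.val = n then
    if h : i.val < n then b ⟨i.val, h⟩
    else if h2 : i.val - n < m - n then d ⟨i.val - n, h2⟩
    else 0
  else if j.val = i.val + 1 then 1 else 0

open Polynomial in
/-- The characteristic matrix of the nilpotent Jordan matrix with blocks of sizes `n`, `m - n`. -/
noncomputable def jordanCharmatrix (n m : ℕ) : Matrix (Fin m) (Fin m) ℂ[X] := fun i j =>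
  (if i = j then X else 0) - (if j.val = i.val + 1 ∧ j.val ≠ n then 1 else 0)

open Polynomial in
/-- The rows `(tⁿ⁻¹, …, 1, 0, …, 0)` and `(0, …, 0, tᵐ⁻ⁿ⁻¹, …, 1)`. -/
noncomputable def jordanRows (n m : ℕ) : Matrix (Fin 2) (Fin m) ℂ[X] :=
  ![fun i => if i.val < n then X ^ (n - 1 - i.val) else 0,
    fun i => if i.val < n then 0 else X ^ (m - 1 - i.val)]

open Polynomial in
/-- The rows selecting the coordinates `0` and `n`. -/
noncomputable def jordanHeads (n m : ℕ) : Matrix (Fin 2) (Fin m) ℂ[X] :=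
  ![fun j => if j.val = 0 then 1 else 0, fun j => if j.val = n then 1 else 0]

theorem Matrix.det_mul_det_sub_mul {R ι κ : Type*} [CommRing R] [Fintype ι] [DecidableEq ι]
    [Fintype κ] [DecidableEq κ] (T : Matrix ι ι R) (F : Matrix ι κ R) (G : Matrix κ ι R)
    (D : Matrix κ κ R) (U : Matrix κ ι R) (h : U * T = D * G) :
    D.det * (T - F * G).det = T.det * (D - U * F).det := by
  have h₁ : fromBlocks 1 0 0 D * fromBlocks T F G 1 = fromBlocks T F (D * G) D := by
    simp [fromBlocks_multiply]
  have h₂ : fromBlocks 1 0 (-U) 1 * fromBlocks T F (D * G) D =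
      fromBlocks T F 0 (D - U * F) := by
    simp [fromBlocks_multiply, h, sub_eq_neg_add]
  have e₁ := congrArg det h₁
  have e₂ := congrArg det h₂
  rw [det_mul, det_fromBlocks_zero₁₂, det_fromBlocks_one₂₂, det_one, one_mul] at e₁
  rw [det_mul, det_fromBlocks_zero₁₂, det_fromBlocks_zero₂₁, det_one, det_one, one_mul,
    one_mul] at e₂
  rw [e₁, e₂]

theorem det_jordanCharmatrix (n m : ℕ) : (jordanCharmatrix n m).det = Polynomial.X ^ m := by
  rw [Matrix.det_of_isUpperTriangular]
  · simp [jordanCharmatrix]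
  · intro i j hij
    have hij' : j.val < i.val := hij
    have h₁ : i ≠ j := by rintro rfl; omega
    have h₂ : ¬ (j.val = i.val + 1 ∧ j.val ≠ n) := by omega
    simp [jordanCharmatrix, h₁, h₂]

theorem mul_jordanCharmatrix_apply {κ : Type*} {n m : ℕ} (U : Matrix κ (Fin m) (Polynomial ℂ))
    (k : κ) (j : Fin m) :
    (U * jordanCharmatrix n m) k j = U k j * Polynomial.X -
      if j.val = 0 ∨ j.val = n then 0 else U k ⟨j.val - 1, by omega⟩ := by
  simp only [Matrix.mul_apply, jordanCharmatrix, mul_sub, Finset.sum_sub_distrib, mul_ite, mul_zero, mul_one,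
    Finset.sum_ite_eq', Finset.mem_univ, if_true]
  congr 1
  split_ifs with h
  · exact Finset.sum_eq_zero fun i _ => if_neg (by omega)
  · rw [Finset.sum_eq_single ⟨j.val - 1, by omega⟩]
    · exact if_pos (by simp only; omega)
    · intro i _ hi
      refine if_neg fun hj => hi (Fin.ext ?_)
      simp only
      omega
    · simp

theorem jordanRows_mul_jordanCharmatrix {n m : ℕ} (hn : 1 ≤ n) (hnm : n < m) :
    jordanRows n m * jordanCharmatrix n m =
      Matrix.diagonal ![Polynomial.X ^ n, Polynomial.X ^ (m - n)] * jordanHeads n m := by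
  ext1 k j
  refine (mul_jordanCharmatrix_apply _ k j).trans (Eq.trans ?_ (Matrix.diagonal_mul _ _ k j).symm)
  have hj := j.isLt
  fin_cases k
  · simp only [jordanRows, jordanHeads, Fin.zero_eta, Matrix.cons_val_zero]
    by_cases h₀ : j.val = 0
    · simp only [h₀, true_or, if_true, if_pos (show 0 < n by omega), ← pow_succ]
      rw [show n - 1 - 0 + 1 = n by omega]
      simp
    · by_cases h₁ : j.val < n
      · rw [if_pos h₁, if_neg (by omega), if_pos (by omega), if_neg h₀, ← pow_succ,
          show n - 1 - j.val + 1 = n - 1 - (j.val - 1) by omega]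
        simp
      · rw [if_neg h₁, if_neg h₀]
        split_ifs <;> first | omega | simp
  · simp only [jordanRows, jordanHeads, Fin.mk_one, Matrix.cons_val_one, Matrix.cons_val_fin_one]
    by_cases h₀ : j.val = n
    · simp only [h₀, or_true, if_true, lt_irrefl, if_false, ← pow_succ]
      rw [show m - 1 - n + 1 = m - n by omega]
      simp
    · by_cases h₁ : j.val < n
      · rw [if_pos h₁, if_neg h₀]
        split_ifs <;> first | omega | simp
      · rw [if_neg h₁, if_neg (by omega), if_neg (by omega), if_neg h₀, ← pow_succ,
          show m - 1 - j.val + 1 = m - 1 - (j.val - 1) by omega]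
        simp

theorem Fin.sum_eq_sum_shift {M : Type*} [AddCommMonoid M] {m k l : ℕ} (h : l + k ≤ m)
    (f : Fin m → M) (g : Fin k → M)
    (hf : ∀ i : Fin m, i.val < l ∨ l + k ≤ i.val → f i = 0)
    (hg : ∀ j : Fin k, f ⟨l + j.val, by omega⟩ = g j) :
    ∑ i, f i = ∑ j, g j := by
  refine (Fintype.sum_of_injective (fun j : Fin k => (⟨l + j.val, by omega⟩ : Fin m))
    ?_ g f ?_ fun j => (hg j).symm).symm
  · intro i j hij
    simpa [Fin.ext_iff] using hij
  · intro i hi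
    refine hf i ?_
    by_contra! hc
    exact hi ⟨⟨i.val - l, by omega⟩, Fin.ext (by simp only; omega)⟩

open Polynomial in
/-- The columns `0` and `n` of the Slodowy-slice matrix. -/
noncomputable def slodowyCols {n m : ℕ} (hnm : n < m) (a b c : Fin n → ℂ)
    (d : Fin (m - n) → ℂ) : Matrix (Fin m) (Fin 2) ℂ[X] := fun i =>
  ![C (slodowyMatrix n m a b c d i ⟨0, by omega⟩), C (slodowyMatrix n m a b c d i ⟨n, hnm⟩)]

theorem charmatrix_slodowyMatrix {n m : ℕ} (hn : 1 ≤ n) (hnm : n < m) (a b c : Fin n → ℂ)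
    (d : Fin (m - n) → ℂ) :
    (slodowyMatrix n m a b c d).charmatrix =
      jordanCharmatrix n m - slodowyCols hnm a b c d * jordanHeads n m := by
  ext1 i j
  rw [Matrix.charmatrix_apply, Matrix.sub_apply, Matrix.mul_apply, Fin.sum_univ_two,
    Matrix.diagonal_apply]
  simp only [jordanCharmatrix, sub_sub]
  congr 1
  simp only [slodowyCols, jordanHeads, Matrix.cons_val_zero, Matrix.cons_val_one,
    Matrix.cons_val_fin_one]
  by_cases h₀ : j.val = 0
  · rw [show (⟨0, by omega⟩ : Fin m) = j from Fin.ext h₀.symm]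
    simp [h₀, show (0 : ℕ) ≠ n by omega]
  · by_cases h₁ : j.val = n
    · rw [show (⟨n, hnm⟩ : Fin m) = j from Fin.ext h₁.symm]
      simp [h₁, show n ≠ 0 by omega]
    · simp only [slodowyMatrix, h₀, h₁]
      split_ifs <;> simp_all

theorem jordanRows_mul_slodowyCols {n m : ℕ} (hn : 1 ≤ n) (hm : 2 * n ≤ m) (hnm : n < m)
    (a b c : Fin n → ℂ) (d : Fin (m - n) → ℂ) :
    jordanRows n m * slodowyCols hnm a b c d =
      !![lowSlicePoly n a, lowSlicePoly n b; lowSlicePoly n c, lowSlicePoly (m - n) d] := by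
  have hn₀ : n ≠ 0 := by omega
  ext1 k l
  rw [Matrix.mul_apply]
  fin_cases k <;> fin_cases l <;>
    simp only [jordanRows, slodowyCols, slodowyMatrix, lowSlicePoly, Fin.zero_eta, Fin.mk_one,
      Matrix.cons_val_zero, Matrix.cons_val_one, Matrix.cons_val_fin_one, Matrix.of_apply, if_true,
      hn₀, if_false]
  · refine Fin.sum_eq_sum_shift (l := 0) (by omega) _ _ (fun i hi => ?_) fun j => ?_
    · rw [if_neg (by omega), zero_mul]
    · have hj : 0 + j.val < n := by omega
      rw [if_pos hj, dif_pos hj, mul_comm]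
      simp
  · refine Fin.sum_eq_sum_shift (l := 0) (by omega) _ _ (fun i hi => ?_) fun j => ?_
    · rw [if_neg (by omega), zero_mul]
    · have hj : 0 + j.val < n := by omega
      rw [if_pos hj, dif_pos hj, mul_comm]
      simp
  · refine Fin.sum_eq_sum_shift (l := m - n) (by omega) _ _ (fun i hi => ?_) fun j => ?_
    · by_cases h : i.val < n
      · rw [if_pos h, zero_mul]
      · rw [dif_neg h, dif_neg (by omega), Polynomial.C_0, mul_zero]
    · have hj : ¬ m - n + j.val < n := by omega
      dsimp only
      rw [if_neg hj, dif_neg hj, dif_pos (by omega), mul_comm,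
        show m - 1 - (m - n + j.val) = n - 1 - j.val by omega]
      simp
  · refine Fin.sum_eq_sum_shift (l := n) (by omega) _ _ (fun i hi => ?_) fun j => ?_
    · rw [if_pos (by omega), zero_mul]
    · have hj : ¬ n + j.val < n := by omega
      dsimp only
      rw [if_neg hj, dif_neg hj, dif_pos (by omega), mul_comm,
        show m - 1 - (n + j.val) = m - n - 1 - j.val by omega]
      simp

/-- For `1 ≤ n`, `2n ≤ m` and `a, b, c ∈ ℂⁿ`, `d ∈ ℂ^{m−n}`, the
characteristic polynomial of the Slodowy-slice matrix factors as
`det(t·1ₘ − M(a,b,c,d)) = p_a(t)·q_d(t) − r_b(t)·s_c(t)`. -/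
theorem statement3 (n m : ℕ) (hn : 1 ≤ n) (hm : 2 * n ≤ m)
    (a b c : Fin n → ℂ) (d : Fin (m - n) → ℂ) :
    (slodowyMatrix n m a b c d).charpoly =
      charSlicePoly n a * charSlicePoly (m - n) d -
        lowSlicePoly n b * lowSlicePoly n c := by
  have hnm : n < m := by omega
  have key := Matrix.det_mul_det_sub_mul _ (slodowyCols hnm a b c d) _ _ _
    (jordanRows_mul_jordanCharmatrix hn hnm)
  rw [← charmatrix_slodowyMatrix hn hnm, jordanRows_mul_slodowyCols hn hm, det_jordanCharmatrix,
    Matrix.det_diagonal, Fin.prod_univ_two, Matrix.det_fin_two] at key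
  simp only [Matrix.cons_val_zero, Matrix.cons_val_one, Matrix.cons_val_fin_one, ← pow_add,
    Nat.add_sub_cancel' hnm.le] at key
  rw [Matrix.charpoly, mul_left_cancel₀ (pow_ne_zero m Polynomial.X_ne_zero) key]
  simp [charSlicePoly, lowSlicePoly]
end

section
/- Let n ≥ 1 be an integer, let P ∈ ℂ[t], and let p, q, r, s ∈ ℂ[t] with p monic of degree n and p·q − r·s = P. Let φ : ℂ[X,Y,Z] → ℂ[t]/(p) be the ℂ-algebra homomorphism sending X to the class of r, Y to the class of s, and Z to the class of t. Then: (i) φ is surjective; (ii) the polynomial XY + P(Z) lies in the kernel J of φ; and (iii) dim_ℂ ℂ[X,Y,Z]/J = n. (This is the well-definedness of Manolescu's embedding: the ideal J = {Q ∈ ℂ[X,Y,Z] : p divides Q(r(t), s(t), t)} defines a length-n subscheme of the surface {XY + P(Z) = 0}.) -/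
/-- Manolescu's homomorphism `φ : ℂ[X,Y,Z] → ℂ[t]/(p)` sending `X` to the class of `r`,
`Y` to the class of `s`, and `Z` to the class of `t`. -/
noncomputable def manolescuHom (p r s : Polynomial ℂ) :
    MvPolynomial (Fin 3) ℂ →ₐ[ℂ] Polynomial ℂ ⧸ Ideal.span {p} :=
  MvPolynomial.aeval
    ![Ideal.Quotient.mk (Ideal.span {p}) r,
      Ideal.Quotient.mk (Ideal.span {p}) s,
      Ideal.Quotient.mk (Ideal.span {p}) Polynomial.X]

/-- Let `n ≥ 1`, `P ∈ ℂ[t]` and `p, q, r, s ∈ ℂ[t]` with `p` monic of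
degree `n` and `p·q − r·s = P`.  Then the map `φ` above is surjective, the polynomial
`X·Y + P(Z)` lies in its kernel `J`, and `dim_ℂ ℂ[X,Y,Z]/J = n`. -/
theorem statement5 (n : ℕ) (hn : 1 ≤ n) (P p q r s : Polynomial ℂ)
    (hp : p.Monic) (hdeg : p.natDegree = n) (hfactor : p * q - r * s = P) :
    Function.Surjective (manolescuHom p r s) ∧
      (MvPolynomial.X 0 * MvPolynomial.X 1 +
          Polynomial.aeval (MvPolynomial.X 2 : MvPolynomial (Fin 3) ℂ) P) ∈
        RingHom.ker (manolescuHom p r s) ∧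
      Module.finrank ℂ
        (MvPolynomial (Fin 3) ℂ ⧸ RingHom.ker (manolescuHom p r s)) = n := by
  have aeval_mk (f : Polynomial ℂ) :
      Polynomial.aeval (Ideal.Quotient.mk (Ideal.span {p}) Polynomial.X) f =
        Ideal.Quotient.mk (Ideal.span {p}) f := by
    have h := Polynomial.aeval_algHom_apply (Ideal.Quotient.mkₐ ℂ (Ideal.span {p}))
      Polynomial.X f
    simpa using h
  have hsurj : Function.Surjective (manolescuHom p r s) := by
    intro y
    obtain ⟨f, rfl⟩ := Ideal.Quotient.mk_surjective y
    refine ⟨Polynomial.aeval (MvPolynomial.X 2) f, ?_⟩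
    rw [← Polynomial.aeval_algHom_apply, ← aeval_mk f]
    simp [manolescuHom]
  refine ⟨hsurj, ?_, ?_⟩
  · rw [RingHom.mem_ker, map_add, map_mul, ← Polynomial.aeval_algHom_apply]
    simp only [manolescuHom, MvPolynomial.aeval_X, Matrix.cons_val]
    rw [aeval_mk, ← map_mul, ← map_add, Ideal.Quotient.eq_zero_iff_mem,
      Ideal.mem_span_singleton, ← hfactor]
    exact ⟨q, by ring⟩
  · rw [(Ideal.quotientKerAlgEquivOfSurjective hsurj).toLinearEquiv.finrank_eq,
      finrank_quotient_span_eq_natDegree, hdeg]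
end

section
/- Fix an integer n ≥ 1. For p ∈ ℂ[t] monic of degree n and r, s ∈ ℂ[t] of degree at most n−1 (or zero), let J(p,r,s) = {Q ∈ ℂ[X,Y,Z] : p divides the image of Q under X ↦ r, Y ↦ s, Z ↦ t}. Then the assignment (p,r,s) ↦ J(p,r,s) is injective: if J(p₁,r₁,s₁) = J(p₂,r₂,s₂) for two such triples, then p₁ = p₂, r₁ = r₂ and s₁ = s₂. (This gives the injectivity of Manolescu's embedding of the slice fibre into the Hilbert scheme of points.) -/
open Polynomial in
/-- Evaluating the last variable at `X` undoes the inclusion of univariate polynomials in it. -/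
lemma aeval_aeval_X_two {R : Type*} [CommRing R] (r s q : R[X]) :
    MvPolynomial.aeval ![r, s, X] (aeval (MvPolynomial.X 2 : MvPolynomial (Fin 3) R) q) = q := by
  rw [← Polynomial.aeval_algHom_apply]
  simp

/-- Fix `n ≥ 1`.  For `p ∈ ℂ[t]` monic of degree `n` and `r, s ∈ ℂ[t]` of
degree at most `n − 1` (or zero), let
`J(p,r,s) = {Q ∈ ℂ[X,Y,Z] : p ∣ Q(r(t), s(t), t)}`.  Then `(p,r,s) ↦ J(p,r,s)` is
injective: if `J(p₁,r₁,s₁) = J(p₂,r₂,s₂)` then `p₁ = p₂`, `r₁ = r₂` and `s₁ = s₂`. -/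
theorem statement6 (n : ℕ) (hn : 1 ≤ n)
    (p₁ p₂ r₁ r₂ s₁ s₂ : Polynomial ℂ)
    (hp₁ : p₁.Monic) (hd₁ : p₁.natDegree = n)
    (hr₁ : r₁.degree < (n : WithBot ℕ)) (hs₁ : s₁.degree < (n : WithBot ℕ))
    (hp₂ : p₂.Monic) (hd₂ : p₂.natDegree = n)
    (hr₂ : r₂.degree < (n : WithBot ℕ)) (hs₂ : s₂.degree < (n : WithBot ℕ))
    (hJ : {Q : MvPolynomial (Fin 3) ℂ |
            p₁ ∣ MvPolynomial.aeval ![r₁, s₁, Polynomial.X] Q} =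
          {Q : MvPolynomial (Fin 3) ℂ |
            p₂ ∣ MvPolynomial.aeval ![r₂, s₂, Polynomial.X] Q}) :
    p₁ = p₂ ∧ r₁ = r₂ ∧ s₁ = s₂ := by
  have hdvd : ∀ Q : MvPolynomial (Fin 3) ℂ,
      p₁ ∣ MvPolynomial.aeval ![r₁, s₁, Polynomial.X] Q ↔
        p₂ ∣ MvPolynomial.aeval ![r₂, s₂, Polynomial.X] Q := fun Q => Set.ext_iff.mp hJ Q
  have hp : p₁ = p₂ := by
    have h := hdvd (Polynomial.aeval (MvPolynomial.X 2) p₁)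
    have h' := hdvd (Polynomial.aeval (MvPolynomial.X 2) p₂)
    simp only [aeval_aeval_X_two, dvd_refl, true_iff, iff_true] at h h'
    exact Polynomial.eq_of_monic_of_associated hp₁ hp₂ (associated_of_dvd_dvd h' h)
  subst hp
  have hdeg : p₁.degree = (n : WithBot ℕ) := by
    rw [Polynomial.degree_eq_natDegree hp₁.ne_zero, hd₁]
  have eq_of_dvd : ∀ a b : Polynomial ℂ, a.degree < (n : WithBot ℕ) → b.degree < (n : WithBot ℕ) →
      p₁ ∣ b - a → a = b := fun a b ha hb h =>
    (sub_eq_zero.mp (Polynomial.eq_zero_of_dvd_of_degree_lt h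
      (hdeg ▸ (Polynomial.degree_sub_le b a).trans_lt (max_lt hb ha)))).symm
  refine ⟨rfl, eq_of_dvd _ _ hr₁ hr₂ ?_, eq_of_dvd _ _ hs₁ hs₂ ?_⟩
  · have h := hdvd (MvPolynomial.X 0 - Polynomial.aeval (MvPolynomial.X 2) r₁)
    rw [map_sub, map_sub, aeval_aeval_X_two, aeval_aeval_X_two] at h
    simpa using h
  · have h := hdvd (MvPolynomial.X 1 - Polynomial.aeval (MvPolynomial.X 2) s₁)
    rw [map_sub, map_sub, aeval_aeval_X_two, aeval_aeval_X_two] at h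
    simpa using h
end

section
/- Let λ ∈ Λ_{n,m} and let c₁ < c₂ be good points of λ. Then either c₁^∧ < c₂ (the pairs (c₁, c₁^∧) and (c₂, c₂^∧) are disjoint) or c₂^∧ < c₁^∧ (the pair (c₂, c₂^∧) is strictly nested inside (c₁, c₁^∧)). In particular c₁^∧ ≠ c₂^∧, so the matching c ↦ c^∧ is injective on the set of good points of λ. (This non-crossing property is what allows the matching paths of the cup and cap diagrams of λ to be realised by pairwise disjoint embedded curves.) -/
open scoped Classical

namespace ArcAlgebra

variable {m : ℕ}

/-- `l : Fin m → Bool` is a weight of type `(n, m)`: positions are `0`-based (position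
`a : Fin m` corresponds to the 1-based position `a.val + 1`), the value `true` stands for
`∨` and `false` for `∧`, and `l` takes the value `∨` exactly `n` times. -/
def IsWeight (n : ℕ) (l : Fin m → Bool) : Prop :=
  (Finset.univ.filter (fun a => l a = true)).card = n

/-- The number of `∨`'s strictly between `c` and `c'` equals the number of `∧`'s strictly
between `c` and `c'`. -/
def Balanced (l : Fin m → Bool) (c c' : Fin m) : Prop :=
  (Finset.univ.filter (fun x => c < x ∧ x < c' ∧ l x = true)).card =
    (Finset.univ.filter (fun x => c < x ∧ x < c' ∧ l x = false)).card

/-- `Matches l c c'` says `c` is a good point of `l` with partner `c^∧ = c'`: one has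
`l c = ∨`, `c < c'`, `l c' = ∧`, the counts of `∨`'s and `∧`'s strictly between `c` and
`c'` balance, and `c'` is minimal with these properties. -/
def Matches (l : Fin m → Bool) (c c' : Fin m) : Prop :=
  l c = true ∧ c < c' ∧ l c' = false ∧ Balanced l c c' ∧
    ∀ d : Fin m, c < d → l d = false → Balanced l c d → c' ≤ d

/-- `c` is a good point of `l`. -/
def IsGood (l : Fin m → Bool) (c : Fin m) : Prop :=
  ∃ c', Matches l c c'

/-- `a` is a ray position of `l`: neither a good point of `l` nor the partner `c^∧` of a
good point `c` of `l`. -/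
def RayPos (l : Fin m → Bool) (a : Fin m) : Prop :=
  ¬ IsGood l a ∧ ¬ ∃ c, Matches l c a

/-- `η` orients the diagram of `l`: `η(c) ≠ η(c^∧)` for every good point `c` of `l`, and
whenever `a < b` are ray positions of `l` with `η a = ∨`, also `η b = ∨`. -/
def Orients (η l : Fin m → Bool) : Prop :=
  (∀ c c', Matches l c c' → η c ≠ η c') ∧
    ∀ a b, RayPos l a → RayPos l b → a < b → η a = true → η b = true

/-- The number of good points of `l`. -/
noncomputable def goodCount (l : Fin m → Bool) : ℕ :=
  (Finset.univ.filter (fun c => IsGood l c)).card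

/-- The weight `w_l`: it takes the value `∨` exactly at the partners `c^∧` of the good
points `c` of `l` and at the `n − goodCount l` largest ray positions of `l` (a ray position
`a` is among the `k` largest ray positions iff fewer than `k` ray positions exceed it). -/
noncomputable def wMax (n : ℕ) (l : Fin m → Bool) : Fin m → Bool := fun a =>
  if (∃ c, Matches l c a) ∨
      (RayPos l a ∧
        (Finset.univ.filter (fun b => RayPos l b ∧ a < b)).card < n - goodCount l)
  then true else false

/-- The Bruhat order on weights: `l ≤ μ` iff there is a bijection `f` from `l⁻¹(∨)` to
`μ⁻¹(∨)` with `x ≤ f x` for all `x`. -/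
def BruhatLE (l μ : Fin m → Bool) : Prop :=
  ∃ f : {x : Fin m // l x = true} → {y : Fin m // μ y = true},
    Function.Bijective f ∧ ∀ x, x.1 ≤ (f x).1

end ArcAlgebra

open ArcAlgebra

namespace ArcAlgebra

variable {m : ℕ}

/-- The number of `∨`'s minus the number of `∧`'s among the positions below `k`. -/
def height (l : Fin m → Bool) (k : ℕ) : ℤ :=
  ∑ x : Fin m, if x.val < k then (if l x = true then 1 else -1) else 0

lemma height_succ (l : Fin m → Bool) (c : Fin m) :
    height l (c.val + 1) = height l c.val + if l c = true then 1 else -1 := by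
  have h : (if l c = true then (1 : ℤ) else -1) =
      ∑ x : Fin m, if x = c then (if l x = true then (1 : ℤ) else -1) else 0 := by
    simp
  rw [h, height, height, ← Finset.sum_add_distrib]
  refine Finset.sum_congr rfl fun x _ => ?_
  simp only [Fin.ext_iff]
  split_ifs <;> omega

lemma balanced_iff_height (l : Fin m → Bool) {c d : Fin m} (hcd : c < d) :
    Balanced l c d ↔ height l d.val = height l (c.val + 1) := by
  have h : height l d.val - height l (c.val + 1) =
      ((Finset.univ.filter (fun x => c < x ∧ x < d ∧ l x = true)).card : ℤ) -
        (Finset.univ.filter (fun x => c < x ∧ x < d ∧ l x = false)).card := by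
    simp only [height, Finset.card_filter, Nat.cast_sum]
    rw [← Finset.sum_sub_distrib, ← Finset.sum_sub_distrib]
    refine Finset.sum_congr rfl fun x _ => ?_
    rw [Fin.lt_def] at hcd
    simp only [Fin.lt_def]
    cases l x <;> simp <;> split_ifs <;> omega
  unfold Balanced
  omega

lemma Matches.height_succ_eq {l : Fin m → Bool} {c d : Fin m} (h : Matches l c d) :
    height l (d.val + 1) = height l c.val := by
  obtain ⟨hc, hcd, hd, hb, -⟩ := h
  rw [balanced_iff_height l hcd] at hb
  rw [height_succ, hb, height_succ]
  simp [hc, hd]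

lemma Matches.height_lt {l : Fin m → Bool} {c d : Fin m} (h : Matches l c d) {k : ℕ}
    (hck : c.val + 1 ≤ k) (hkd : k ≤ d.val) : height l c.val < height l k := by
  obtain ⟨hc, -, -, -, hmin⟩ := h
  have hs := height_succ l c
  rw [if_pos hc] at hs
  induction k, hck using Nat.le_induction with
  | base => omega
  | succ k hk ih =>
    have ih := ih (by omega)
    let x : Fin m := ⟨k, by omega⟩
    have hx : height l (k + 1) = height l k + if l x = true then 1 else -1 := height_succ l x
    cases hl : l x with
    | true => simp only [hl, if_true] at hx; omega
    | false =>
      have hcx : c < x := Fin.lt_def.2 hk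
      have hne : height l k ≠ height l (c.val + 1) := fun he => by
        have : d.val ≤ k := hmin x hcx hl ((balanced_iff_height l hcx).2 he)
        omega
      simp only [hl, Bool.false_eq_true, if_false] at hx
      omega

lemma Matches.lt_or_lt {l : Fin m → Bool} {c₁ c₂ d₁ d₂ : Fin m} (h12 : c₁ < c₂)
    (h₁ : Matches l c₁ d₁) (h₂ : Matches l c₂ d₂) : d₁ < c₂ ∨ d₂ < d₁ := by
  by_contra! ⟨hc, hd⟩
  rw [Fin.lt_def] at h12
  rw [Fin.le_def] at hc hd
  have hlt := h₁.height_lt (k := c₂.val) h12 hc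
  have e₁ := h₁.height_succ_eq
  have e₂ := h₂.height_succ_eq
  rcases hd.eq_or_lt with hd | hd
  · rw [hd] at e₁
    omega
  · have := h₂.height_lt (k := d₁.val + 1) (by omega) hd
    omega

lemma Matches.partner_ne {l : Fin m → Bool} {c₁ c₂ d₁ d₂ : Fin m} (h12 : c₁ < c₂)
    (h₁ : Matches l c₁ d₁) (h₂ : Matches l c₂ d₂) : d₁ ≠ d₂ := by
  rintro rfl
  rcases h₁.lt_or_lt h12 h₂ with h | h
  · exact lt_asymm h h₂.2.1
  · exact lt_irrefl _ h

end ArcAlgebra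

/-- Let `λ ∈ Λ_{n,m}` and let `c₁ < c₂` be good points of `λ` with
partners `d₁ = c₁^∧`, `d₂ = c₂^∧`.  Then either `d₁ < c₂` (the pairs are disjoint) or
`d₂ < d₁` (the pair `(c₂, c₂^∧)` is strictly nested inside `(c₁, c₁^∧)`).  In particular
`d₁ ≠ d₂`, so the matching `c ↦ c^∧` is injective on the set of good points of `λ`. -/
theorem statement7 (n m : ℕ) (l : Fin m → Bool) (hl : IsWeight n l)
    (c₁ c₂ d₁ d₂ : Fin m) (h12 : c₁ < c₂)
    (h₁ : Matches l c₁ d₁) (h₂ : Matches l c₂ d₂) :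
    (d₁ < c₂ ∨ d₂ < d₁) ∧ d₁ ≠ d₂ ∧
      ∀ c c' e : Fin m, Matches l c e → Matches l c' e → c = c' := by
  refine ⟨h₁.lt_or_lt h12 h₂, h₁.partner_ne h12 h₂, fun c c' e h h' => ?_⟩
  rcases lt_trichotomy c c' with hlt | heq | hlt
  · exact absurd rfl (h.partner_ne hlt h')
  · exact heq
  · exact absurd rfl (h'.partner_ne hlt h)
end

section
/- Let λ ∈ Λ_{n,m} have g good points. Then n − g does not exceed the number of ray positions of λ, so w_λ is a well-defined element of Λ_{n,m}; w_λ orients the diagram of λ; and every η ∈ Λ_{n,m} that orients the diagram of λ satisfies η ≤ w_λ in the Bruhat order. Hence the set {w ∈ Λ_{n,m} : the circle diagram \underline{λ}w\overline{λ} is oriented} is nonempty and has w_λ as its unique Bruhat-maximal element. -/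
open scoped Classical

open ArcAlgebra

namespace ArcAlgebra

variable {m : ℕ}

lemma Matches.right_unique {l : Fin m → Bool} {c c' d' : Fin m}
    (h : Matches l c c') (h' : Matches l c d') : c' = d' :=
  le_antisymm (h.2.2.2.2 _ h'.2.1 h'.2.2.1 h'.2.2.2.1)
    (h'.2.2.2.2 _ h.2.1 h.2.2.1 h.2.2.2.1)

/-- Counting the value `b` on an open interval, split at an interior point `d`. -/
lemma card_filter_between_split (l : Fin m → Bool) (b : Bool) {c d e : Fin m}
    (hcd : c < d) (hde : d < e) :
    (Finset.univ.filter (fun x => c < x ∧ x < e ∧ l x = b)).card =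
      (Finset.univ.filter (fun x => c < x ∧ x < d ∧ l x = b)).card +
        (if l d = b then 1 else 0) +
        (Finset.univ.filter (fun x => d < x ∧ x < e ∧ l x = b)).card := by
  have hd : (if l d = b then 1 else 0) =
      (Finset.univ.filter (fun x => x = d ∧ l x = b)).card := by
    split_ifs with h
    · rw [eq_comm, Finset.card_eq_one]
      exact ⟨d, by ext x; simp; rintro rfl; exact h⟩
    · rw [eq_comm, Finset.card_eq_zero]
      ext x
      simp
      rintro rfl
      simpa using h
  rw [hd, ← Finset.card_union_of_disjoint, ← Finset.card_union_of_disjoint]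
  · congr 1
    ext x
    simp only [Finset.mem_filter, Finset.mem_univ, true_and, Finset.mem_union]
    grind
  · rw [Finset.disjoint_left]
    intro x
    simp only [Finset.mem_filter, Finset.mem_univ, true_and, Finset.mem_union]
    grind
  · rw [Finset.disjoint_left]
    intro x
    simp only [Finset.mem_filter, Finset.mem_univ, true_and]
    grind

/-- If the `∧`'s outnumber the `∨`'s strictly between `c` and `d`, then some earlier `∧`
closes up a balanced interval starting at `c`. -/
lemma exists_balanced_of_card_lt (l : Fin m → Bool) {c d : Fin m}
    (h : (Finset.univ.filter (fun x => c < x ∧ x < d ∧ l x = true)).card <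
      (Finset.univ.filter (fun x => c < x ∧ x < d ∧ l x = false)).card) :
    ∃ p, c < p ∧ p < d ∧ l p = false ∧ Balanced l c p := by
  induction hk : d.val using Nat.strong_induction_on generalizing d with
  | _ k ih =>
    obtain ⟨x, hx⟩ := Finset.card_pos.1 (Nat.zero_lt_of_lt h)
    simp only [Finset.mem_filter, Finset.mem_univ, true_and] at hx
    obtain ⟨hcx, hxd, -⟩ := hx
    let p : Fin m := ⟨d.val - 1, by omega⟩
    have hpd : p < d := by simp only [Fin.lt_def, p] at *; omega
    have hcp : c < p := by simp only [Fin.lt_def, p] at *; omega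
    by_cases hp : (Finset.univ.filter (fun x => c < x ∧ x < p ∧ l x = true)).card <
      (Finset.univ.filter (fun x => c < x ∧ x < p ∧ l x = false)).card
    · obtain ⟨q, h1, h2, h3⟩ := ih p.val (by omega) hp rfl
      exact ⟨q, h1, h2.trans hpd, h3⟩
    · have hempty : ∀ b, (Finset.univ.filter (fun x => p < x ∧ x < d ∧ l x = b)).card = 0 := by
        intro b
        rw [Finset.card_eq_zero]
        ext y
        simp only [Finset.mem_filter, Finset.mem_univ, true_and, Finset.notMem_empty, iff_false]
        simp only [Fin.lt_def, p]
        omega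
      rw [card_filter_between_split l true hcp hpd, card_filter_between_split l false hcp hpd,
        hempty, hempty] at h
      refine ⟨p, hcp, hpd, ?_, ?_⟩
      · by_contra hne
        simp only [Bool.not_eq_false] at hne
        simp only [hne] at h
        simp at h
        omega
      · unfold Balanced
        cases hlp : l p <;> simp [hlp] at h <;> omega

lemma Matches.not_lt_left {l : Fin m → Bool} {c d c' : Fin m}
    (h : Matches l c c') (h' : Matches l d c') : ¬ c < d := by
  intro hcd
  obtain ⟨-, -, -, hb, hmin⟩ := h
  obtain ⟨hld, hdc, -, hb', -⟩ := h'
  unfold Balanced at hb hb'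
  rw [card_filter_between_split l true hcd hdc, card_filter_between_split l false hcd hdc] at hb
  simp only [hld] at hb
  simp at hb
  obtain ⟨p, hcp, hpd, hlp, hbp⟩ := exists_balanced_of_card_lt l (c := c) (d := d) (by omega)
  exact absurd (hmin p hcp hlp hbp) (not_le.2 (hpd.trans hdc))

lemma Matches.left_unique {l : Fin m → Bool} {c d c' : Fin m}
    (h : Matches l c c') (h' : Matches l d c') : c = d :=
  le_antisymm (not_lt.1 (h'.not_lt_left h)) (not_lt.1 (h.not_lt_left h'))

lemma Matches.not_matches_left {l : Fin m → Bool} {c c' e : Fin m}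
    (h : Matches l c c') : ¬ Matches l e c := by
  intro h'
  have h1 := h.1
  rw [h'.2.2.1] at h1
  exact Bool.false_ne_true h1

/-- A function that separates each good point from its partner takes the value `∨` at
exactly `goodCount l` positions that are not ray positions. -/
lemma card_true_eq (l η : Fin m → Bool) (hη : ∀ c c', Matches l c c' → η c ≠ η c') :
    (Finset.univ.filter (fun a => η a = true)).card =
      (Finset.univ.filter (fun a => RayPos l a ∧ η a = true)).card + goodCount l := by
  have hp : ∀ c, ∃ c', IsGood l c → Matches l c c' := by
    intro c
    by_cases h : IsGood l c
    · exact ⟨h.choose, fun _ => h.choose_spec⟩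
    · exact ⟨c, fun h' => absurd h' h⟩
  choose p hp using hp
  have himage : Finset.univ.filter (fun a => ¬ RayPos l a ∧ η a = true) =
      (Finset.univ.filter (fun c => IsGood l c)).image (fun c => if η c = true then c else p c) := by
    ext a
    simp only [Finset.mem_filter, Finset.mem_univ, true_and, Finset.mem_image]
    constructor
    · rintro ⟨hr, ha⟩
      by_cases hg : IsGood l a
      · exact ⟨a, hg, by simp [ha]⟩
      · have : ∃ c, Matches l c a := by
          by_contra hc
          exact hr ⟨hg, hc⟩
        obtain ⟨c, hc⟩ := this
        refine ⟨c, ⟨a, hc⟩, ?_⟩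
        have hne := hη _ _ hc
        rw [ha] at hne
        rw [if_neg hne]
        exact (hp c ⟨a, hc⟩).right_unique hc
    · rintro ⟨c, hc, rfl⟩
      have hm := hp c hc
      have hne := hη _ _ hm
      split_ifs with h
      · exact ⟨fun hr => hr.1 hc, h⟩
      · refine ⟨fun hr => hr.2 ⟨c, hm⟩, ?_⟩
        cases h1 : η c <;> cases h2 : η (p c) <;> simp_all
  have hcard : (Finset.univ.filter (fun a => ¬ RayPos l a ∧ η a = true)).card = goodCount l := by
    rw [himage, Finset.card_image_of_injOn]
    · rfl
    · intro c hc d hd hcd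
      simp only [Finset.coe_filter, Finset.mem_univ, true_and, Set.mem_ofPred_eq] at hc hd
      have hmc := hp c hc
      have hmd := hp d hd
      simp only at hcd
      split_ifs at hcd with h1 h2 h2
      · exact hcd
      · exact absurd (hcd ▸ hmd) hmc.not_matches_left
      · exact absurd (hcd ▸ hmc) hmd.not_matches_left
      · exact hmc.left_unique (hcd ▸ hmd)
  rw [← hcard, ← Finset.card_union_of_disjoint]
  · congr 1
    ext a
    simp only [Finset.mem_filter, Finset.mem_univ, true_and, Finset.mem_union]
    tauto
  · rw [Finset.disjoint_left]
    intro a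
    simp only [Finset.mem_filter, Finset.mem_univ, true_and]
    tauto

/-- A finite set with at least `k` elements has exactly `k` elements exceeded by fewer than
`k` others. -/
lemma card_filter_card_gt_lt {α : Type*} [LinearOrder α] (S : Finset α) {k : ℕ}
    (hk : k ≤ S.card) :
    (S.filter (fun a => (S.filter (fun b => a < b)).card < k)).card = k := by
  let r : α → ℕ := fun a => (S.filter (fun b => a < b)).card
  have hlt : ∀ a b, b ∈ S → a < b → r b < r a := by
    intro a b hb hab
    apply Finset.card_lt_card
    rw [Finset.ssubset_iff_of_subset]
    · exact ⟨b, by simp [hb, hab], by simp⟩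
    · intro x
      simp only [Finset.mem_filter]
      exact fun hx => ⟨hx.1, hab.trans hx.2⟩
  have hinj : Set.InjOn r S := by
    intro a ha b hb hab
    rcases lt_trichotomy a b with h | h | h
    · exact absurd hab (hlt a b hb h).ne'
    · exact h
    · exact absurd hab (hlt b a ha h).ne
  have himage : S.image r = Finset.range S.card := by
    apply Finset.eq_of_subset_of_card_le
    · intro i hi
      obtain ⟨a, ha, rfl⟩ := Finset.mem_image.1 hi
      rw [Finset.mem_range]
      apply Finset.card_lt_card
      rw [Finset.ssubset_iff_of_subset (Finset.filter_subset _ _)]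
      exact ⟨a, ha, by simp⟩
    · rw [Finset.card_image_of_injOn hinj, Finset.card_range]
  have hfilter : (S.filter (fun a => r a < k)).image r = Finset.range k := by
    ext i
    simp only [Finset.mem_image, Finset.mem_filter, Finset.mem_range]
    constructor
    · rintro ⟨a, ⟨-, h⟩, rfl⟩
      exact h
    · intro hi
      have : i ∈ S.image r := by
        rw [himage, Finset.mem_range]
        omega
      obtain ⟨a, ha, rfl⟩ := Finset.mem_image.1 this
      exact ⟨a, ⟨ha, hi⟩, rfl⟩
  have h := Finset.card_image_of_injOn
    (hinj.mono (fun a ha => (Finset.mem_filter.1 ha).1 :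
      ((S.filter (fun a => r a < k) : Finset α) : Set α) ⊆ S))
  rw [hfilter, Finset.card_range] at h
  exact h.symm

lemma wMax_eq_true_iff (n : ℕ) (l : Fin m → Bool) (a : Fin m) :
    wMax n l a = true ↔ (∃ c, Matches l c a) ∨
      (RayPos l a ∧
        (Finset.univ.filter (fun b => RayPos l b ∧ a < b)).card < n - goodCount l) := by
  simp [wMax]

lemma Matches.ne_self {l : Fin m → Bool} {c c' : Fin m} (h : Matches l c c') : l c ≠ l c' := by
  rw [h.1, h.2.2.1]
  simp

lemma Matches.wMax_ne {l : Fin m → Bool} (n : ℕ) {c c' : Fin m} (h : Matches l c c') :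
    wMax n l c ≠ wMax n l c' := by
  have h1 : wMax n l c' = true := (wMax_eq_true_iff _ _ _).2 (Or.inl ⟨c, h⟩)
  rw [h1, Ne, wMax_eq_true_iff]
  rintro (⟨e, he⟩ | ⟨hr, -⟩)
  · exact h.not_matches_left he
  · exact hr.1 ⟨c', h⟩

lemma orients_wMax (n : ℕ) (l : Fin m → Bool) : Orients (wMax n l) l := by
  refine ⟨fun c c' h => h.wMax_ne n, fun a b ha hb hab h => ?_⟩
  rw [wMax_eq_true_iff] at h ⊢
  rcases h with h | ⟨-, h⟩
  · exact absurd h ha.2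
  · refine Or.inr ⟨hb, lt_of_le_of_lt (Finset.card_le_card fun x => ?_) h⟩
    simp only [Finset.mem_filter, Finset.mem_univ, true_and]
    exact fun hx => ⟨hx.1, hab.trans hx.2⟩

lemma sub_goodCount_le_card_rayPos {n : ℕ} {l : Fin m → Bool} (hl : IsWeight n l) :
    n - goodCount l ≤ (Finset.univ.filter (fun a => RayPos l a)).card := by
  have h := card_true_eq l l (fun c c' h => h.ne_self)
  have hle : (Finset.univ.filter (fun a => RayPos l a ∧ l a = true)).card ≤
      (Finset.univ.filter (fun a => RayPos l a)).card :=
    Finset.card_le_card fun x => by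
      simp only [Finset.mem_filter, Finset.mem_univ, true_and]
      exact fun hx => hx.1
  unfold IsWeight at hl
  omega

lemma isWeight_wMax {n : ℕ} {l : Fin m → Bool} (hl : IsWeight n l) : IsWeight n (wMax n l) := by
  have h := card_true_eq l (wMax n l) (fun c c' h => h.wMax_ne n)
  have h' := card_true_eq l l (fun c c' h => h.ne_self)
  have hk := card_filter_card_gt_lt _ (sub_goodCount_le_card_rayPos hl)
  have heq : (Finset.univ.filter (fun a => RayPos l a ∧ wMax n l a = true)).card =
      n - goodCount l := by
    rw [← hk]
    congr 1
    ext a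
    simp only [Finset.mem_filter, Finset.mem_univ, true_and, wMax_eq_true_iff,
      Finset.filter_filter]
    constructor
    · rintro ⟨hr, hc | hc⟩
      · exact absurd hc hr.2
      · exact hc
    · exact fun hc => ⟨hc.1, Or.inr hc⟩
  unfold IsWeight at hl ⊢
  omega

lemma wMax_eq_true_of_rayPos {n : ℕ} {l η : Fin m → Bool} (hw : IsWeight n η)
    (hη : Orients η l) {a : Fin m} (ha : RayPos l a) (h : η a = true) : wMax n l a = true := by
  refine (wMax_eq_true_iff _ _ _).2 (Or.inr ⟨ha, ?_⟩)
  have hc := card_true_eq l η hη.1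
  have hlt : (Finset.univ.filter (fun b => RayPos l b ∧ a < b)).card <
      (Finset.univ.filter (fun b => RayPos l b ∧ η b = true)).card := by
    apply Finset.card_lt_card
    rw [Finset.ssubset_iff_of_subset]
    · exact ⟨a, by simp [ha, h], by simp⟩
    · intro b
      simp only [Finset.mem_filter, Finset.mem_univ, true_and]
      exact fun hb => ⟨hb.1, hη.2 a b ha hb.1 hb.2 h⟩
  unfold IsWeight at hw
  omega

lemma bruhatLE_wMax {n : ℕ} {l η : Fin m → Bool} (hl : IsWeight n l) (hw : IsWeight n η)
    (hη : Orients η l) : BruhatLE η (wMax n l) := by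
  have hp : ∀ c, ∃ c', Matches l c c' ∨ (¬ IsGood l c ∧ c' = c) := by
    intro c
    by_cases h : IsGood l c
    · exact ⟨h.choose, Or.inl h.choose_spec⟩
    · exact ⟨c, Or.inr ⟨h, rfl⟩⟩
  choose p hp using hp
  have hmem : ∀ x, η x = true → wMax n l (p x) = true := by
    intro x hx
    rcases hp x with h | ⟨hg, h⟩
    · exact (wMax_eq_true_iff _ _ _).2 (Or.inl ⟨x, h⟩)
    · rw [h]
      by_cases hc : ∃ c, Matches l c x
      · exact (wMax_eq_true_iff _ _ _).2 (Or.inl hc)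
      · exact wMax_eq_true_of_rayPos hw hη ⟨hg, hc⟩ hx
  have hinj : ∀ x y, η x = true → η y = true → p x = p y → x = y := by
    intro x y hx hy hxy
    rcases hp x with h | ⟨-, h⟩ <;> rcases hp y with h' | ⟨-, h'⟩
    · exact h.left_unique (hxy ▸ h')
    · rw [hxy, h'] at h
      exact absurd (hx.trans hy.symm) (hη.1 _ _ h)
    · rw [← hxy, h] at h'
      exact absurd (hy.trans hx.symm) (hη.1 _ _ h')
    · rw [← h, hxy, h']
  refine ⟨fun x => ⟨p x.1, hmem x.1 x.2⟩, ?_, fun x => ?_⟩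
  · rw [Fintype.bijective_iff_injective_and_card]
    refine ⟨fun x y hxy => Subtype.ext (hinj _ _ x.2 y.2 (congrArg Subtype.val hxy)), ?_⟩
    have hw' := isWeight_wMax hl
    unfold IsWeight at hw hw'
    rw [Fintype.card_subtype, Fintype.card_subtype]
    exact hw.trans hw'.symm
  · rcases hp x.1 with h | ⟨-, h⟩
    · exact h.2.1.le
    · exact h.ge

end ArcAlgebra

/-- Let `λ ∈ Λ_{n,m}` have `g` good points.  Then `n − g` does not
exceed the number of ray positions of `λ` (so `w_λ` is a well-defined element of
`Λ_{n,m}`); `w_λ` orients the diagram of `λ`; and every `η ∈ Λ_{n,m}` that orients the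
diagram of `λ` satisfies `η ≤ w_λ` in the Bruhat order.  Hence the set
`{w ∈ Λ_{n,m} : \underline{λ}w\overline{λ} is oriented}` is nonempty and has `w_λ` as its
unique Bruhat-maximal element. -/
theorem statement12 (n m : ℕ) (l : Fin m → Bool) (hl : IsWeight n l) :
    n - goodCount l ≤ (Finset.univ.filter (fun a => RayPos l a)).card ∧
    IsWeight n (wMax n l) ∧
    Orients (wMax n l) l ∧
    ∀ η : Fin m → Bool, IsWeight n η → Orients η l → BruhatLE η (wMax n l) :=
  ⟨sub_goodCount_le_card_rayPos hl, isWeight_wMax hl, orients_wMax n l,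
    fun _ hw hη => bruhatLE_wMax hl hw hη⟩
end

section
/- Let n, m be integers with 0 ≤ 2n ≤ m, and define bc on Λ_{n,m} by: bc(λ) is the function on {1,…,2(m−n)} with bc(λ)(a) = ∨ for a ≤ m−2n and bc(λ)(a) = λ(a−(m−2n)) for a > m−2n. Then bc(λ) ∈ Λ_{m−n,2(m−n)} for every λ ∈ Λ_{n,m}, and if λ is a compact weight then bc(λ) is a compact weight; that is, bc maps Λ^c_{n,m} into Λ^c_{m−n,2(m−n)}. -/
open scoped Classical

open ArcAlgebra

/-- The map `bc : Λ_{n,m} → Λ_{m−n,2(m−n)}` (for `2n ≤ m`): in 1-based coordinates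
`bc(λ)(a) = ∨` for `a ≤ m−2n` and `bc(λ)(a) = λ(a−(m−2n))` for `a > m−2n`. -/
def ArcAlgebra.bcw (n m : ℕ) (l : Fin m → Bool) : Fin (2 * (m - n)) → Bool := fun a =>
  if a.val < m - 2 * n then true
  else if h : a.val - (m - 2 * n) < m then l ⟨a.val - (m - 2 * n), h⟩
  else false

/-- The sign of the `i`-th position of `l`: `1` for `∨`, `-1` for `∧`, and `0` outside the
range of positions. -/
def ArcAlgebra.sign {m : ℕ} (l : Fin m → Bool) (i : ℕ) : ℤ :=
  if h : i < m then (if l ⟨i, h⟩ = true then 1 else -1) else 0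

/-- The number of `∨`'s minus the number of `∧`'s among the first `j` positions of `l`. -/
def ArcAlgebra.height_s17 {m : ℕ} (l : Fin m → Bool) (j : ℕ) : ℤ :=
  ∑ i ∈ Finset.range j, sign l i

namespace ArcAlgebra

variable {m : ℕ} (l : Fin m → Bool)

theorem height_succ_s17 (j : ℕ) : height_s17 l (j + 1) = height_s17 l j + sign l j :=
  Finset.sum_range_succ _ _

theorem sign_of_true {c : Fin m} (h : l c = true) : sign l c = 1 := by
  simp [sign, h]

theorem sign_of_false {c : Fin m} (h : l c = false) : sign l c = -1 := by
  simp [sign, h]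

theorem card_sub_card (p : Fin m → Prop) [DecidablePred p] :
    ((Finset.univ.filter (fun x => p x ∧ l x = true)).card : ℤ) -
      (Finset.univ.filter (fun x => p x ∧ l x = false)).card =
        ∑ x : Fin m, if p x then sign l x else 0 := by
  rw [Finset.card_filter, Finset.card_filter]
  push_cast
  rw [← Finset.sum_sub_distrib]
  refine Finset.sum_congr rfl fun x _ => ?_
  by_cases hp : p x <;> cases hx : l x <;> simp [hp, hx, sign]

theorem balanced_iff {c c' : Fin m} (hcc : c < c') :
    Balanced l c c' ↔ height_s17 l c' = height_s17 l (c + 1) := by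
  have hcc' : (c : ℕ) < c' := hcc
  have hc' : (c' : ℕ) < m := c'.2
  have h := card_sub_card l (fun x => c < x ∧ x < c')
  simp only [and_assoc] at h
  have hs : (∑ x : Fin m, if c < x ∧ x < c' then sign l x else 0) =
      height_s17 l c' - height_s17 l (c + 1) := by
    have h2 := Finset.sum_range
      (fun i : ℕ => if (c : ℕ) < i ∧ i < (c' : ℕ) then sign l i else 0) (n := m)
    simp only [Fin.lt_def]
    rw [← h2, ← Finset.sum_filter, height_s17, height_s17, ← Finset.sum_Ico_eq_sub _ (by omega)]
    refine Finset.sum_congr ?_ fun _ _ => rfl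
    ext i
    simp only [Finset.mem_filter, Finset.mem_range, Finset.mem_Ico]
    omega
  rw [hs] at h
  unfold Balanced
  omega

theorem isWeight_iff (n : ℕ) : IsWeight n l ↔ height_s17 l m = 2 * n - m := by
  have h := card_sub_card l (fun _ => True)
  simp only [true_and, if_true] at h
  rw [← Finset.sum_range (sign l)] at h
  have h2 := Finset.card_filter_add_card_filter_not
    (s := (Finset.univ : Finset (Fin m))) (fun x => l x = true)
  simp only [Bool.not_eq_true, Finset.card_univ, Fintype.card_fin] at h2
  unfold IsWeight height_s17
  omega

theorem isGood_iff {c : Fin m} (hc : l c = true) :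
    IsGood l c ↔ ∃ j, (c : ℕ) < j ∧ j ≤ m ∧ height_s17 l j < height_s17 l (c + 1) := by
  constructor
  · rintro ⟨c', -, hlt, hf, hb, -⟩
    rw [balanced_iff l hlt] at hb
    refine ⟨c' + 1, Nat.lt_succ_of_lt hlt, c'.2, ?_⟩
    rw [height_succ_s17, sign_of_false l hf, hb]
    omega
  · intro hex
    obtain ⟨hj1, hj2, hj3⟩ := Nat.find_spec hex
    have hmin := fun i (hi : i < Nat.find hex) => Nat.find_min hex hi
    generalize Nat.find hex = j at hj1 hj2 hj3 hmin
    obtain ⟨i, rfl⟩ : ∃ i, j = i + 1 := ⟨j - 1, by omega⟩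
    have hne : i ≠ c := by rintro rfl; omega
    have hci : (c : ℕ) < i := by omega
    have hi := hmin i (by omega)
    have hge : height_s17 l (c + 1) ≤ height_s17 l i := by
      by_contra hlt
      exact hi ⟨hci, by omega, by omega⟩
    have hs := height_succ_s17 l i
    have hmem : ∃ d : Fin m, c < d ∧ l d = false ∧ Balanced l c d := by
      cases hf : l ⟨i, hj2⟩ with
      | true =>
        have := sign_of_true l hf
        simp only at this
        omega
      | false =>
        have := sign_of_false l hf
        simp only at this
        have hcd : c < ⟨i, hj2⟩ := hci
        refine ⟨_, hcd, hf, (balanced_iff l hcd).2 ?_⟩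
        simp only
        omega
    obtain ⟨d, hd, hle⟩ := WellFounded.has_min (wellFounded_lt (α := Fin m))
      {d | c < d ∧ l d = false ∧ Balanced l c d} hmem
    exact ⟨d, hc, hd.1, hd.2.1, hd.2.2,
      fun e h1 h2 h3 => not_lt.1 (hle e ⟨h1, h2, h3⟩)⟩

theorem height_bcw_of_le (n : ℕ) {j : ℕ} (hj : j ≤ m - 2 * n) :
    height_s17 (bcw n m l) j = j := by
  induction j with
  | zero => simp [height_s17]
  | succ j ih =>
    rw [height_succ_s17, ih (by omega), sign, dif_pos (by omega : j < 2 * (m - n))]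
    simp [bcw, show j < m - 2 * n by omega]

theorem height_bcw_add {n : ℕ} (h2nm : 2 * n ≤ m) {j : ℕ} (hj : j ≤ m) :
    height_s17 (bcw n m l) (m - 2 * n + j) = (m - 2 * n : ℕ) + height_s17 l j := by
  induction j with
  | zero => simpa [height_s17] using height_bcw_of_le l n le_rfl
  | succ j ih =>
    have hs : sign (bcw n m l) (m - 2 * n + j) = sign l j := by
      rw [sign, sign, dif_pos (by omega : m - 2 * n + j < 2 * (m - n)),
        dif_pos (by omega : j < m)]
      simp [bcw, show j < m by omega]
    rw [← add_assoc, height_succ_s17, height_succ_s17, ih (by omega), hs, add_assoc]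

theorem height_bcw_last {n : ℕ} (h2nm : 2 * n ≤ m) (hl : IsWeight n l) :
    height_s17 (bcw n m l) (2 * (m - n)) = 0 := by
  rw [isWeight_iff] at hl
  have h := height_bcw_add l h2nm le_rfl
  rw [show m - 2 * n + m = 2 * (m - n) by omega] at h
  omega

end ArcAlgebra

/-- Let `0 ≤ 2n ≤ m`.  Then `bc(λ) ∈ Λ_{m−n,2(m−n)}` for every
`λ ∈ Λ_{n,m}`, and if `λ` is a compact weight then so is `bc(λ)`; that is, `bc` maps
`Λ^c_{n,m}` into `Λ^c_{m−n,2(m−n)}`. -/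
theorem statement17 (n m : ℕ) (h2nm : 2 * n ≤ m) :
    (∀ l : Fin m → Bool, IsWeight n l → IsWeight (m - n) (bcw n m l)) ∧
    ∀ l : Fin m → Bool, IsWeight n l → (∀ c, l c = true → IsGood l c) →
      ∀ c, bcw n m l c = true → IsGood (bcw n m l) c := by
  refine ⟨fun l hl => ?_, fun l hl hcomp c hc => ?_⟩
  · rw [isWeight_iff, height_bcw_last l h2nm hl]
    push_cast
    ring
  · rw [isGood_iff _ hc]
    rcases lt_or_ge (c : ℕ) (m - 2 * n) with hk | hk
    · refine ⟨2 * (m - n), c.2, le_rfl, ?_⟩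
      rw [height_bcw_last l h2nm hl, height_bcw_of_le l n (Nat.succ_le_of_lt hk)]
      positivity
    · have hc2 := c.2
      have hd : (c : ℕ) - (m - 2 * n) < m := by omega
      have hld : l ⟨c - (m - 2 * n), hd⟩ = true := by
        simpa [bcw, hd, not_lt.2 hk] using hc
      obtain ⟨j, hj1, hj2, hj3⟩ := (isGood_iff l hld).1 (hcomp _ hld)
      simp only at hj1 hj3
      refine ⟨m - 2 * n + j, by omega, by omega, ?_⟩
      rw [show (c : ℕ) + 1 = m - 2 * n + (c - (m - 2 * n) + 1) by omega,
        height_bcw_add l h2nm hj2, height_bcw_add l h2nm (by omega)]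
      omega
end

section
/- Let 0 ≤ n ≤ m and define e on Λ_{n,m} by: e(λ) is the function on {1,…,m+n} with e(λ)(a) = λ(a) for a ≤ m and e(λ)(a) = ∧ for m < a ≤ m+n. Then e(λ) is a compact weight in Λ^c_{n,m+n} for every λ ∈ Λ_{n,m}; that is, appending n symbols ∧ to any weight of type (n,m) makes every ∨ a good point. -/
open scoped Classical

open ArcAlgebra

/-- The map `e : Λ_{n,m} → Λ_{n,m+n}` appending `n` symbols `∧`: in 1-based coordinates
`e(λ)(a) = λ(a)` for `a ≤ m` and `e(λ)(a) = ∧` for `m < a ≤ m+n`. -/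
def ArcAlgebra.ew (n m : ℕ) (l : Fin m → Bool) : Fin (m + n) → Bool := fun a =>
  if h : a.val < m then l ⟨a.val, h⟩ else false

namespace ArcAlgebra

/-- A good point exists as soon as some partner candidate exists: the least one works. -/
theorem IsGood.of_balanced {M : ℕ} {l : Fin M → Bool} {c d : Fin M} (hc : l c = true)
    (hcd : c < d) (hd : l d = false) (hb : Balanced l c d) : IsGood l c := by
  obtain ⟨a, ⟨h1, h2, h3⟩, hmin⟩ := (wellFounded_lt (α := Fin M)).has_min
    {d | c < d ∧ l d = false ∧ Balanced l c d} ⟨d, hcd, hd, hb⟩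
  exact ⟨a, hc, h1, h2, h3, fun x hx hx' hx'' => not_lt.1 (hmin x ⟨hx, hx', hx''⟩)⟩

/-- The number of positions after `c` and with index less than `k` where `l` takes the
value `b`. -/
noncomputable def countBetween {M : ℕ} (l : Fin M → Bool) (c : Fin M) (b : Bool) (k : ℕ) : ℕ :=
  (Finset.univ.filter (fun x => c < x ∧ x.val < k ∧ l x = b)).card

theorem countBetween_mono {M : ℕ} (l : Fin M → Bool) (c : Fin M) (b : Bool) :
    Monotone (countBetween l c b) := by
  intro i j hij
  refine Finset.card_le_card fun x hx => ?_
  simp only [Finset.mem_filter, Finset.mem_univ, true_and] at hx ⊢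
  exact ⟨hx.1, hx.2.1.trans_le hij, hx.2.2⟩

theorem exists_of_countBetween_lt_succ {M : ℕ} {l : Fin M → Bool} {c : Fin M} {b : Bool} {k : ℕ}
    (h : countBetween l c b k < countBetween l c b (k + 1)) :
    ∃ d : Fin M, d.val = k ∧ c < d ∧ l d = b ∧
      countBetween l c b (k + 1) ≤ countBetween l c b k + 1 := by
  obtain ⟨d, hd, hd'⟩ := Finset.exists_mem_notMem_of_card_lt_card h
  simp only [Finset.mem_filter, Finset.mem_univ, true_and] at hd hd'
  have hdk : d.val = k := by
    by_contra hne
    exact hd' ⟨hd.1, by omega, hd.2.2⟩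
  refine ⟨d, hdk, hd.1, hd.2.2, ?_⟩
  refine (Finset.card_le_card (t := insert d _) fun x hx => ?_).trans (Finset.card_insert_le _ _)
  simp only [Finset.mem_insert, Finset.mem_filter, Finset.mem_univ, true_and, Fin.ext_iff] at hx ⊢
  by_cases hxk : x.val = d.val
  · exact Or.inl hxk
  · exact Or.inr ⟨hx.1, by omega, hx.2.2⟩

/-- If more `∧`'s than `∨`'s occur after a `∨` at `c`, then `c` is a good point. -/
theorem IsGood.of_card_lt {M : ℕ} {l : Fin M → Bool} {c : Fin M} (hc : l c = true)
    (h : (Finset.univ.filter (fun x => c < x ∧ l x = true)).card <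
      (Finset.univ.filter (fun x => c < x ∧ l x = false)).card) : IsGood l c := by
  have hex : ∃ k, countBetween l c true k < countBetween l c false k :=
    ⟨M, by simpa [countBetween] using h⟩
  obtain ⟨k, hk, hmin⟩ : ∃ k, countBetween l c true k < countBetween l c false k ∧
      ∀ j < k, ¬ countBetween l c true j < countBetween l c false j :=
    ⟨Nat.find hex, Nat.find_spec hex, fun _ => Nat.find_min hex⟩
  cases k with
  | zero => simp [countBetween] at hk
  | succ k =>
    have hle := hmin k k.lt_succ_self
    have hT := countBetween_mono l c true (Nat.le_add_right k 1)
    obtain ⟨d, rfl, hcd, hd, hF⟩ := exists_of_countBetween_lt_succ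
      (l := l) (c := c) (b := false) (k := k) (by omega)
    refine IsGood.of_balanced hc hcd hd ?_
    change countBetween l c true d.val = countBetween l c false d.val
    omega

theorem ew_castAdd {n m : ℕ} (l : Fin m → Bool) (a : Fin m) :
    ew n m l (Fin.castAdd n a) = l a := by
  simp [ew]

theorem ew_natAdd {n m : ℕ} (l : Fin m → Bool) (a : Fin n) :
    ew n m l (Fin.natAdd m a) = false := by
  simp [ew]

theorem IsWeight.ew {k n m : ℕ} {l : Fin m → Bool} (hl : IsWeight k l) :
    IsWeight k (ew n m l) := by
  refine Eq.trans ?_ ((Finset.card_map (Fin.castAddEmb n)).trans hl)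
  congr 1
  ext x
  refine Fin.addCases (fun a => ?_) (fun a => ?_) x
  · simp [ew_castAdd]
  · simp only [Finset.mem_filter, Finset.mem_univ, true_and, ew_natAdd, Finset.mem_map,
      Fin.castAddEmb_apply, Fin.ext_iff, Fin.val_castAdd, Fin.val_natAdd]
    constructor
    · simp
    · rintro ⟨y, -, hy⟩
      omega

end ArcAlgebra

/-- Let `0 ≤ n ≤ m` and `λ ∈ Λ_{n,m}`.  Then `e(λ)` is a compact weight
in `Λ^c_{n,m+n}`: appending `n` symbols `∧` to any weight of type `(n,m)` makes every `∨`
a good point. -/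
theorem statement18 (n m : ℕ) (hnm : n ≤ m) (l : Fin m → Bool) (hl : IsWeight n l) :
    IsWeight n (ew n m l) ∧ ∀ c, ew n m l c = true → IsGood (ew n m l) c := by
  refine ⟨hl.ew, fun c hc => IsGood.of_card_lt hc ?_⟩
  have hcm : c.val < m := by
    by_contra hcm
    simp [ew, hcm] at hc
  calc _ < n := by
        refine (Finset.card_lt_card
          (Finset.ssubset_iff_of_subset ?_ |>.2 ⟨c, ?_, ?_⟩)).trans_eq (hl.ew (n := n))
        · intro x hx
          simp only [Finset.mem_filter] at hx ⊢
          exact ⟨hx.1, hx.2.2⟩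
        · simpa using hc
        · simp
    _ = (Finset.univ.map (Fin.natAddEmb (m := n) m)).card := by simp
    _ ≤ _ := by
        refine Finset.card_le_card fun x hx => ?_
        obtain ⟨a, -, rfl⟩ := Finset.mem_map.1 hx
        simp only [Finset.mem_filter, Finset.mem_univ, true_and, Fin.natAddEmb_apply, ew_natAdd,
          and_true, Fin.lt_def, Fin.val_natAdd]
        omega
end
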